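/- Let a : ℕ → ℝ with a_n > 0 for all n and b : ℕ → ℂ. If sup_n a_n < ∞, then the maximal Jacobi operator J(a,b) is proper, i.e. the closure of the minimal operator J₀(a,b) equals J(a,b). -/

import Mathlib

open scoped InnerProductSpace ComplexConjugate

noncomputable section

/-- The Hilbert space `ℓ²(ℕ₀)` of square-summable complex sequences. -/
abbrev H : Type := lp (fun _ : ℕ => ℂ) 2

/-- The formal Jacobi action: `(Ju)ₙ = aₙ₋₁uₙ₋₁ + bₙuₙ + aₙuₙ₊₁` (with `u₋₁ = 0`). -/
def jacobiAct (a : ℕ → ℝ) (b : ℕ → ℂ) (u : ℕ → ℂ) : ℕ → ℂ := fun n =>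
  (if n = 0 then 0 else (a (n - 1) : ℂ) * u (n - 1)) + b n * u n + (a n : ℂ) * u (n + 1)

lemma jacobiAct_add (a : ℕ → ℝ) (b : ℕ → ℂ) (u v : ℕ → ℂ) :
    jacobiAct a b (u + v) = jacobiAct a b u + jacobiAct a b v := by
  funext n
  by_cases h : n = 0 <;> simp [jacobiAct, h] <;> ring

lemma jacobiAct_smul (a : ℕ → ℝ) (b : ℕ → ℂ) (c : ℂ) (u : ℕ → ℂ) :
    jacobiAct a b (c • u) = c • jacobiAct a b u := by
  funext n
  by_cases h : n = 0 <;> simp [jacobiAct, h] <;> ring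

lemma jacobiAct_zero (a : ℕ → ℝ) (b : ℕ → ℂ) : jacobiAct a b 0 = 0 := by
  funext n
  by_cases h : n = 0 <;> simp [jacobiAct, h]

/-- The domain of the maximal Jacobi operator: all `u ∈ ℓ²` whose formal Jacobi action is
again in `ℓ²`. -/
def jacobiDomain (a : ℕ → ℝ) (b : ℕ → ℂ) : Submodule ℂ H where
  carrier := {u : H | Memℓp (jacobiAct a b ⇑u) 2}
  zero_mem' := by
    have h : Memℓp (jacobiAct a b 0) 2 := by
      rw [jacobiAct_zero]
      exact zero_memℓp (E := fun _ : ℕ => ℂ) (p := 2)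
    exact h
  add_mem' := by
    intro u v hu hv
    have h : Memℓp (jacobiAct a b (⇑u + ⇑v)) 2 := by
      rw [jacobiAct_add]
      exact Memℓp.add hu hv
    exact h
  smul_mem' := by
    intro c u hu
    simpa [lp.coeFn_smul, jacobiAct_smul] using hu.const_smul c

/-- The maximal Jacobi operator `J(a,b)`, as a partially defined linear operator on
`ℓ²(ℕ₀)`. -/
def jacobiOp (a : ℕ → ℝ) (b : ℕ → ℂ) : H →ₗ.[ℂ] H where
  domain := jacobiDomain a b
  toFun :=
    { toFun := fun u => (⟨jacobiAct a b ⇑(u : H), u.2⟩ : H)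
      map_add' := by
        intro u v
        apply Subtype.ext
        exact jacobiAct_add a b _ _
      map_smul' := by
        intro c u
        apply Subtype.ext
        exact jacobiAct_smul a b c _ }

/-- The subspace `ℓ²_c(ℕ₀)` of finitely supported sequences. -/
def finSupp : Submodule ℂ H where
  carrier := {u : H | (Function.support ⇑u).Finite}
  zero_mem' := by simp [Function.support]
  add_mem' := by
    intro u v hu hv
    refine Set.Finite.subset (hu.union hv) ?_
    intro n hn
    simp only [Function.mem_support, lp.coeFn_add, Pi.add_apply] at hn
    by_contra hc
    simp only [Set.mem_union, Function.mem_support, not_or, not_not] at hc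
    exact hn (by rw [hc.1, hc.2, add_zero])
  smul_mem' := by
    intro c u hu
    refine Set.Finite.subset hu ?_
    intro n hn
    simp only [Function.mem_support, lp.coeFn_smul, Pi.smul_apply, smul_eq_mul] at hn
    simp only [Function.mem_support]
    intro h
    exact hn (by rw [h, mul_zero])

lemma finSupp_memℓp (a : ℕ → ℝ) (b : ℕ → ℂ) (u : ℕ → ℂ)
    (hu : (Function.support u).Finite) : Memℓp (jacobiAct a b u) 2 := by
  have hfin : (((· + 1) '' Function.support u ∪ Function.support u) ∪
      ((· - 1) '' Function.support u)).Finite :=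
    ((hu.image _).union hu).union (hu.image _)
  refine (memℓp_zero (hfin.subset ?_)).of_exponent_ge zero_le
  intro n hn
  simp only [Set.mem_setOf_eq, jacobiAct] at hn
  by_contra hc
  simp only [Set.mem_union, Set.mem_image, Function.mem_support, not_or, not_exists,
    not_and] at hc
  obtain ⟨⟨h1, h2⟩, h3⟩ := hc
  have e2 : u n = 0 := not_not.1 h2
  have e3 : u (n + 1) = 0 := by
    by_contra hne
    exact h3 (n + 1) hne (by omega)
  apply hn
  by_cases h : n = 0
  · subst h; simp [e2, show u 1 = 0 from e3]
  · have e1 : u (n - 1) = 0 := by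
      by_contra hne
      exact h1 (n - 1) hne (by omega)
    simp [h, e1, e2, e3]

/-- The minimal Jacobi operator `J₀(a,b)`: the restriction of the maximal operator to the
finitely supported sequences. -/
def jacobiOp₀ (a : ℕ → ℝ) (b : ℕ → ℂ) : H →ₗ.[ℂ] H where
  domain := finSupp
  toFun :=
    { toFun := fun u => (⟨jacobiAct a b ⇑(u : H), finSupp_memℓp a b _ u.2⟩ : H)
      map_add' := by
        intro u v
        apply Subtype.ext
        exact jacobiAct_add a b _ _
      map_smul' := by
        intro c u
        apply Subtype.ext
        exact jacobiAct_smul a b c _ }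

/-- The Wronskian `Wₙ(u,v) = aₙ(uₙ₊₁vₙ − uₙvₙ₊₁)`. -/
def wronskian (a : ℕ → ℝ) (u v : ℕ → ℂ) (n : ℕ) : ℂ :=
  (a n : ℂ) * (u (n + 1) * v n - u n * v (n + 1))


/-- The coordinate functionals on `ℓ²(ℕ₀)` are continuous. -/
lemma continuous_coord (n : ℕ) : Continuous fun u : H => u n :=
  (lp.lipschitzWith_one_eval 2 n).continuous

lemma mem_graph_jacobiOp {a : ℕ → ℝ} {b : ℕ → ℂ} {u v : H} :
    (u, v) ∈ (jacobiOp a b).graph ↔ jacobiAct a b u = v := by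
  rw [LinearPMap.mem_graph_iff]
  constructor
  · rintro ⟨y, rfl, hv⟩
    exact congrArg (fun w : H => (w : ℕ → ℂ)) hv
  · intro h
    have hu : Memℓp (jacobiAct a b u) 2 := h ▸ lp.memℓp v
    exact ⟨⟨u, hu⟩, rfl, Subtype.ext h⟩

lemma mem_graph_jacobiOp₀ {a : ℕ → ℝ} {b : ℕ → ℂ} {u v : H} :
    (u, v) ∈ (jacobiOp₀ a b).graph ↔ u ∈ finSupp ∧ jacobiAct a b u = v := by
  rw [LinearPMap.mem_graph_iff]
  constructor
  · rintro ⟨y, rfl, hv⟩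
    exact ⟨y.2, congrArg (fun w : H => (w : ℕ → ℂ)) hv⟩
  · rintro ⟨hu, h⟩
    exact ⟨⟨u, hu⟩, rfl, Subtype.ext h⟩

/-- The maximal Jacobi operator is closed. -/
lemma isClosed_jacobiOp (a : ℕ → ℝ) (b : ℕ → ℂ) : (jacobiOp a b).IsClosed := by
  have h : ((jacobiOp a b).graph : Set (H × H)) =
      ⋂ n, {p : H × H | jacobiAct a b p.1 n = p.2 n} := by
    ext ⟨u, v⟩
    simp only [SetLike.mem_coe, mem_graph_jacobiOp, Set.mem_iInter, Set.mem_ofPred_eq, funext_iff]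
  rw [LinearPMap.IsClosed, h]
  refine isClosed_iInter fun n => isClosed_eq ?_ ((continuous_coord n).comp continuous_snd)
  have hc (m : ℕ) : Continuous fun p : H × H => p.1 m := (continuous_coord m).comp continuous_fst
  unfold jacobiAct
  split_ifs
  · exact (continuous_const.add (continuous_const.mul (hc n))).add
      (continuous_const.mul (hc (n + 1)))
  · exact ((continuous_const.mul (hc (n - 1))).add (continuous_const.mul (hc n))).add
      (continuous_const.mul (hc (n + 1)))

/-- The truncation of `u` to its first `N` entries. -/
def truncate (u : H) (N : ℕ) : H := ∑ i ∈ Finset.range N, lp.single 2 i (u i)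

lemma truncate_apply (u : H) (N n : ℕ) : truncate u N n = if n < N then u n else 0 := by
  simp only [truncate, lp.coeFn_sum, Finset.sum_apply, lp.coeFn_single, Finset.sum_pi_single,
    Finset.mem_range]

lemma truncate_mem_finSupp (u : H) (N : ℕ) : truncate u N ∈ finSupp := by
  refine (Finset.range N).finite_toSet.subset fun n hn => ?_
  by_contra h
  exact hn (by rw [truncate_apply, if_neg (by simpa using h)])

lemma tendsto_truncate (u : H) :
    Filter.Tendsto (fun N => truncate u (N + 1)) Filter.atTop (nhds u) :=
  (lp.hasSum_single (by norm_num) u).tendsto_sum_nat.comp (Filter.tendsto_add_atTop_nat 1)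

/-- The Jacobi action commutes with truncation up to two boundary terms. -/
lemma jacobiAct_truncate (a : ℕ → ℝ) (b : ℕ → ℂ) {u v : H} (h : jacobiAct a b u = v) (N : ℕ) :
    jacobiAct a b (truncate u (N + 1)) =
      (truncate v (N + 1) - lp.single 2 N ((a N : ℂ) * u (N + 1)) +
        lp.single 2 (N + 1) ((a N : ℂ) * u N) : H) := by
  funext n
  simp only [lp.coeFn_add, lp.coeFn_sub, Pi.add_apply, Pi.sub_apply, truncate_apply, ← h,
    lp.coeFn_single, Pi.single_apply, jacobiAct]
  rcases lt_trichotomy n N with hn | rfl | hn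
  · simp [show n < N + 1 by omega, show n - 1 < N + 1 by omega, hn, hn.ne,
      show n ≠ N + 1 by omega]
  · simp [show n - 1 < n + 1 by omega]
  · rcases eq_or_ne n (N + 1) with rfl | hn'
    · simp
    · simp [show ¬ n < N + 1 by omega, show ¬ n - 1 < N + 1 by omega, hn', hn.ne', hn.not_gt]

/-- An entry of an `ℓ²` sequence times a bounded factor, placed anywhere, tends to zero. -/
lemma tendsto_single_mul {a : ℕ → ℝ} (ha : ∀ n, 0 < a n) (hbdd : BddAbove (Set.range a)) (u : H)
    {i j : ℕ → ℕ} (hj : Filter.Tendsto j Filter.atTop Filter.atTop) :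
    Filter.Tendsto (fun N => (lp.single 2 (i N) ((a N : ℂ) * u (j N)) : H))
      Filter.atTop (nhds 0) := by
  obtain ⟨C, hC⟩ := hbdd
  have hu : Filter.Tendsto (fun n => ‖u n‖) Filter.atTop (nhds 0) := by
    have hs := (lp.hasSum_single (by norm_num) u).summable.tendsto_atTop_zero.norm
    simpa [lp.norm_single] using hs
  have hCu : Filter.Tendsto (fun N => C * ‖u (j N)‖) Filter.atTop (nhds 0) := by
    simpa using (hu.comp hj).const_mul C
  refine squeeze_zero_norm (fun N => ?_) hCu
  rw [lp.norm_single (by norm_num), norm_mul, Complex.norm_real, Real.norm_of_nonneg (ha N).le]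
  exact mul_le_mul_of_nonneg_right (hC ⟨N, rfl⟩) (norm_nonneg _)

/-- **Bounded off-diagonal coefficients imply properness** (Corollary 2.4): if
`supₙ aₙ < ∞`, then the closure of the minimal Jacobi operator equals the maximal
operator. -/
theorem proper_of_bddAbove (a : ℕ → ℝ) (ha : ∀ n, 0 < a n) (b : ℕ → ℂ)
    (hbdd : BddAbove (Set.range a)) :
    (jacobiOp₀ a b).closure = jacobiOp a b := by
  have hle : (jacobiOp₀ a b).graph ≤ (jacobiOp a b).graph := fun ⟨u, v⟩ h =>
    mem_graph_jacobiOp.2 (mem_graph_jacobiOp₀.1 h).2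
  have hgraph : (jacobiOp₀ a b).graph.topologicalClosure = (jacobiOp a b).graph := by
    refine le_antisymm (Submodule.topologicalClosure_minimal _ hle (isClosed_jacobiOp a b)) ?_
    rintro ⟨u, v⟩ huv
    have hv := ((tendsto_truncate v).sub (tendsto_single_mul ha hbdd u (i := id)
      (Filter.tendsto_add_atTop_nat 1))).add
        (tendsto_single_mul ha hbdd u (i := (· + 1)) Filter.tendsto_id)
    rw [sub_zero, add_zero] at hv
    exact mem_closure_of_tendsto ((tendsto_truncate u).prodMk_nhds hv) <| .of_forall fun N =>
      mem_graph_jacobiOp₀.2 ⟨truncate_mem_finSupp u _,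
        jacobiAct_truncate a b (mem_graph_jacobiOp.1 huv) N⟩
  have hclosable : (jacobiOp₀ a b).IsClosable := ⟨_, hgraph⟩
  exact LinearPMap.eq_of_eq_graph (hclosable.graph_closure_eq_closure_graph.symm.trans hgraph)

end
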